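/- If a family of c.e. sets is TxtEx*-learned from computable enumerations by a computable learner M (i.e., M TxtEx*-identifies every computable enumeration of every member of the family), then the family is TxtEx*-learned from arbitrary enumerations by some computable learner. -/

import Mathlib

/-- `Wset e` is the `e`-th computably enumerable set: the domain of the `e`-th
partial computable function in the standard numbering by codes. -/
def Wset (e : ℕ) : Set ℕ :=
  {x | ((Denumerable.ofNat Nat.Partrec.Code e).eval x).Dom}

/-- The `i`-th column `{x : ⟨i,x⟩ ∈ W_a}` of the c.e. set coded by `a`;
the number `a` codes the u.c.e. family whose members are its columns. -/
def column (a i : ℕ) : Set ℕ := {x | Nat.pair i x ∈ Wset a}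

/-- The initial segment of length `n` of an enumeration `f`. -/
def initSeg (f : ℕ → ℕ) (n : ℕ) : List ℕ := (List.range n).map f

/-- The `m`-th computable learner in the standard effective enumeration of all
partial computable functions from finite sequences to ℕ. -/
def learnerOfCode (m : ℕ) : List ℕ →. ℕ :=
  fun σ => (Denumerable.ofNat Nat.Partrec.Code m).eval (Encodable.encode σ)

/-- `M` TxtFin-identifies the enumeration `f` (here `Option.none` plays the
role of the symbol `?`). -/
def TxtFinIdentifies (M : List ℕ →. Option ℕ) (f : ℕ → ℕ) : Prop :=
  ∃ n h, (∀ n' < n, M (initSeg f n') = Part.some Option.none) ∧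
    M (initSeg f n) = Part.some (Option.some h) ∧ Wset h = Set.range f

/-- `M` TxtFin-learns the set `S`. -/
def TxtFinLearnsSet (M : List ℕ →. Option ℕ) (S : Set ℕ) : Prop :=
  ∀ f : ℕ → ℕ, Set.range f = S → TxtFinIdentifies M f

/-- `M` TxtEx-identifies the enumeration `f`. -/
def TxtExIdentifies (M : List ℕ →. ℕ) (f : ℕ → ℕ) : Prop :=
  ∃ n, (∃ N, ∀ i ≥ N, M (initSeg f i) = Part.some n) ∧ Wset n = Set.range f

/-- `M` TxtEx-learns the set `S`. -/
def TxtExLearnsSet (M : List ℕ →. ℕ) (S : Set ℕ) : Prop :=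
  ∀ f : ℕ → ℕ, Set.range f = S → TxtExIdentifies M f

/-- `M` TxtBC-identifies the enumeration `f`. -/
def TxtBCIdentifies (M : List ℕ →. ℕ) (f : ℕ → ℕ) : Prop :=
  ∃ N, ∀ i ≥ N, ∃ h, M (initSeg f i) = Part.some h ∧ Wset h = Set.range f

/-- `M` TxtBC-learns the set `S`. -/
def TxtBCLearnsSet (M : List ℕ →. ℕ) (S : Set ℕ) : Prop :=
  ∀ f : ℕ → ℕ, Set.range f = S → TxtBCIdentifies M f

/-- `M` TxtEx*-identifies the enumeration `f`. -/
def TxtExStarIdentifies (M : List ℕ →. ℕ) (f : ℕ → ℕ) : Prop :=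
  ∃ n, (∃ N, ∀ i ≥ N, M (initSeg f i) = Part.some n) ∧
    (symmDiff (Wset n) (Set.range f)).Finite

/-- `M` TxtEx*-learns the set `S`. -/
def TxtExStarLearnsSet (M : List ℕ →. ℕ) (S : Set ℕ) : Prop :=
  ∀ f : ℕ → ℕ, Set.range f = S → TxtExStarIdentifies M f

/-- Indices of cofinite c.e. sets. -/
def COF : Set ℕ := {e | (Wset e)ᶜ.Finite}

/-- Indices of coinfinite c.e. sets. -/
def COINF : Set ℕ := {e | (Wset e)ᶜ.Infinite}

/-- `P` is Σ⁰₃: definable by `∃∀∃` over a computable relation. -/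
def IsSigma3 (P : Set ℕ) : Prop :=
  ∃ R : ℕ → ℕ → ℕ → ℕ → Bool,
    Computable (fun p : ℕ × ℕ × ℕ × ℕ => R p.1 p.2.1 p.2.2.1 p.2.2.2) ∧
    ∀ e, e ∈ P ↔ ∃ x, ∀ y, ∃ z, R e x y z = true

/-- `P` is Σ⁰₄: definable by `∃∀∃∀` over a computable relation. -/
def IsSigma4 (P : Set ℕ) : Prop :=
  ∃ R : ℕ → ℕ → ℕ → ℕ → ℕ → Bool,
    Computable (fun p : ℕ × ℕ × ℕ × ℕ × ℕ =>
      R p.1 p.2.1 p.2.2.1 p.2.2.2.1 p.2.2.2.2) ∧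
    ∀ e, e ∈ P ↔ ∃ x, ∀ y, ∃ z, ∀ w, R e x y z w = true

/-- `P` is Σ⁰₅: definable by `∃∀∃∀∃` over a computable relation. -/
def IsSigma5 (P : Set ℕ) : Prop :=
  ∃ R : ℕ → ℕ → ℕ → ℕ → ℕ → ℕ → Bool,
    Computable (fun p : ℕ × ℕ × ℕ × ℕ × ℕ × ℕ =>
      R p.1 p.2.1 p.2.2.1 p.2.2.2.1 p.2.2.2.2.1 p.2.2.2.2.2) ∧
    ∀ e, e ∈ P ↔ ∃ x, ∀ y, ∃ z, ∀ w, ∃ v, R e x y z w v = true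

/-- `f : ℕ → ℕ` is Δ⁰₂: the pointwise limit of a computable function. -/
def IsDelta2Fun (f : ℕ → ℕ) : Prop :=
  ∃ g : ℕ → ℕ → ℕ, Computable₂ g ∧ ∀ x, ∃ s₀, ∀ s ≥ s₀, g s x = f x

open Nat.Partrec (Code)

theorem initSeg_length (f : ℕ → ℕ) (n : ℕ) : (initSeg f n).length = n := by
  simp [initSeg]

theorem initSeg_take (f : ℕ → ℕ) {m n : ℕ} (h : m ≤ n) :
    (initSeg f n).take m = initSeg f m := by
  simp [initSeg, ← List.map_take, List.take_range, h]

theorem mem_initSeg {f : ℕ → ℕ} {n x : ℕ} : x ∈ initSeg f n ↔ ∃ i < n, f i = x := by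
  simp [initSeg]

theorem initSeg_comp (g f : ℕ → ℕ) (n : ℕ) : initSeg (g ∘ f) n = (initSeg f n).map g := by
  simp [initSeg]

/-- A list of elements of the range of `g` is the image of a list of indices. -/
theorem exists_map_eq_of_forall_mem_range {g : ℕ → ℕ} {σ : List ℕ}
    (h : ∀ x ∈ σ, x ∈ Set.range g) : ∃ l : List ℕ, l.map g = σ := by
  have : σ ∈ Set.range (List.map g) := by
    rw [Set.range_list_map]
    exact h
  exact this

/-- `σ` is a locking sequence for `M'` on `S`. -/
def IsLocking (M' : List ℕ → ℕ) (S : Set ℕ) (σ : List ℕ) : Prop :=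
  (∀ x ∈ σ, x ∈ S) ∧ ∀ ρ : List ℕ, (∀ x ∈ ρ, x ∈ S) → M' (σ ++ ρ) = M' σ

/-! ### Totalising a learner -/

/-- The longest prefix of `σ` on which `c` is seen to converge within `σ.length` steps. -/
def convergentPrefix (c : Code) (σ : List ℕ) : List ℕ :=
  σ.take (Nat.findGreatest
    (fun i => (Code.evaln σ.length c (Encodable.encode (σ.take i))).isSome = true) σ.length)

/-- A primitive recursive learner that delays the learner computed by `c`. -/
def delayedLearner (c : Code) (σ : List ℕ) : ℕ :=
  (Code.evaln σ.length c (Encodable.encode (convergentPrefix c σ))).getD 0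

theorem primrec_evaln_take (c : Code) :
    Primrec₂ fun (σ : List ℕ) (i : ℕ) =>
      Code.evaln σ.length c (Encodable.encode (σ.take i)) :=
  Code.primrec_evaln.comp
    (((Primrec.list_length.comp Primrec.fst).pair (Primrec.const c)).pair
      (Primrec.encode.comp (Primrec.list_take.comp Primrec.snd Primrec.fst)))

theorem primrec_delayedLearner (c : Code) : Primrec (delayedLearner c) := by
  have hp : PrimrecRel fun (σ : List ℕ) (i : ℕ) =>
      (Code.evaln σ.length c (Encodable.encode (σ.take i))).isSome = true :=
    Primrec.eq.comp (Primrec.option_isSome.comp (primrec_evaln_take c)) (Primrec.const true)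
  have hfind := Primrec.nat_findGreatest Primrec.list_length hp
  exact Primrec.option_getD.comp ((primrec_evaln_take c).comp Primrec.id hfind) (Primrec.const 0)

theorem delayedLearner_eventually_eq {M : List ℕ →. ℕ} {c : Code}
    (hc : ∀ σ, c.eval (Encodable.encode σ) = M σ) {f : ℕ → ℕ} {n N : ℕ}
    (hf : ∀ i ≥ N, M (initSeg f i) = Part.some n) :
    ∃ N', ∀ i ≥ N', delayedLearner c (initSeg f i) = n := by
  have hN : n ∈ c.eval (Encodable.encode (initSeg f N)) := by
    rw [hc, hf N le_rfl]
    exact Part.mem_some n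
  obtain ⟨k, hk⟩ := Code.evaln_complete.1 hN
  refine ⟨max k N, fun i hi => ?_⟩
  have hki : k ≤ i := le_trans (le_max_left _ _) hi
  have hNi : N ≤ i := le_trans (le_max_right _ _) hi
  set p : ℕ → Prop := fun j =>
    (Code.evaln (initSeg f i).length c (Encodable.encode ((initSeg f i).take j))).isSome = true
    with hp
  have hpN : p N := by
    have := Code.evaln_mono hki hk
    simp only [hp, initSeg_length, initSeg_take f hNi]
    rw [Option.mem_def.1 this]
    rfl
  have hNl : N ≤ (initSeg f i).length := by rwa [initSeg_length]
  have hle : N ≤ Nat.findGreatest p (initSeg f i).length := Nat.le_findGreatest hNl hpN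
  have hspec : p (Nat.findGreatest p (initSeg f i).length) := Nat.findGreatest_spec hNl hpN
  have hle' : Nat.findGreatest p (initSeg f i).length ≤ i :=
    (Nat.findGreatest_le _).trans (initSeg_length f i).le
  obtain ⟨m, hm⟩ := Option.isSome_iff_exists.1 hspec
  have hm' := Code.evaln_sound (Option.mem_def.2 hm)
  rw [initSeg_take f hle', hc, hf _ hle, Part.mem_some_iff] at hm'
  have hpre : convergentPrefix c (initSeg f i) =
      (initSeg f i).take (Nat.findGreatest p (initSeg f i).length) := rfl
  rw [delayedLearner, hpre, hm, hm']
  rfl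

/-! ### Computable enumerations -/

theorem exists_primrec_range_eq_Wset {e : ℕ} (he : (Wset e).Nonempty) :
    ∃ g : ℕ → ℕ, Primrec g ∧ Set.range g = Wset e := by
  obtain ⟨x₀, hx₀⟩ := he
  set c := Denumerable.ofNat Code e with hc
  let g : ℕ → ℕ := fun n =>
    bif (Code.evaln n.unpair.2 c n.unpair.1).isSome then n.unpair.1 else x₀
  refine ⟨g, ?_, ?_⟩
  · have h1 : Primrec fun n : ℕ => n.unpair.1 := Primrec.fst.comp Primrec.unpair
    have h2 : Primrec fun n : ℕ => n.unpair.2 := Primrec.snd.comp Primrec.unpair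
    exact Primrec.cond (Primrec.option_isSome.comp
      (Code.primrec_evaln.comp ((h2.pair (Primrec.const c)).pair h1))) h1
      (Primrec.const x₀)
  · ext x
    constructor
    · rintro ⟨n, rfl⟩
      by_cases h : (Code.evaln n.unpair.2 c n.unpair.1).isSome = true
      · obtain ⟨y, hy⟩ := Option.isSome_iff_exists.1 h
        have : g n = n.unpair.1 := by simp [g, h]
        rw [this]
        exact Part.dom_iff_mem.2 ⟨y, Code.evaln_sound (Option.mem_def.2 hy)⟩
      · have : g n = x₀ := by simp [g, h]
        rwa [this]
    · intro hx
      obtain ⟨y, hy⟩ := Part.dom_iff_mem.1 hx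
      obtain ⟨k, hk⟩ := Code.evaln_complete.1 hy
      refine ⟨Nat.pair x k, ?_⟩
      have : Code.evaln k c x = some y := hk
      simp [g, this]

theorem Computable.nat_find {α : Type*} [Primcodable α] {p : α → ℕ → Bool} (hp : Computable₂ p)
    (h : ∀ a, ∃ k, p a k = true) : Computable fun a => Nat.find (h a) := by
  refine Partrec.of_eq (Partrec.rfind (p := fun a => (p a : ℕ →. Bool)) hp.partrec₂) fun a => ?_
  refine Part.eq_some_iff.2 (Nat.mem_rfind.2 ⟨?_, fun {m} hm => ?_⟩)
  · exact Part.mem_some_iff.2 (Nat.find_spec (h a)).symm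
  · refine Part.mem_some_iff.2 ?_
    have := Nat.find_min (h a) hm
    simpa using this

/-- If every list can be extended so as to change the value of `M'`, then a computable
surjection makes `M'` diverge. -/
theorem exists_computable_surjective_not_convergent {M' : List ℕ → ℕ} (hM : Computable M')
    (hneg : ∀ l, ∃ r, M' (l ++ r) ≠ M' l) :
    ∃ f : ℕ → ℕ, Computable f ∧ Function.Surjective f ∧
      ∀ n N, ∃ i ≥ N, M' (initSeg f i) ≠ n := by
  have hneg' : ∀ l : List ℕ, ∃ k : ℕ,
      (!decide (M' (l ++ Denumerable.ofNat (List ℕ) k) = M' l)) = true := by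
    intro l
    obtain ⟨r, hr⟩ := hneg l
    exact ⟨Encodable.encode r, by simpa using hr⟩
  have hcomp : Computable fun l : List ℕ => Nat.find (hneg' l) := by
    refine Computable.nat_find
      (p := fun l k => !decide (M' (l ++ Denumerable.ofNat (List ℕ) k) = M' l)) ?_ hneg'
    have hdec : Primrec₂ fun a b : ℕ => decide (a = b) := Primrec.eq.decide
    refine (Primrec.not.to_comp).comp (hdec.to_comp.comp (hM.comp
      (Computable.list_append.comp Computable.fst ?_)) (hM.comp Computable.fst))
    exact (Computable.ofNat (List ℕ)).comp Computable.snd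
  let ext : List ℕ → List ℕ := fun l => l ++ Denumerable.ofNat (List ℕ) (Nat.find (hneg' l))
  have hext : Computable ext :=
    Computable.list_append.comp Computable.id ((Computable.ofNat (List ℕ)).comp hcomp)
  have hext_ne : ∀ l, M' (ext l) ≠ M' l := fun l => by
    simpa [ext] using Nat.find_spec (hneg' l)
  let F : ℕ → List ℕ := fun n => Nat.rec [] (fun k l => ext (l ++ [k])) n
  have hF : Computable F := by
    refine Computable.nat_rec (f := fun n : ℕ => n) (g := fun _ => [])
      (h := fun _ (p : ℕ × List ℕ) => ext (p.2 ++ [p.1])) Computable.id (Computable.const _) ?_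
    exact hext.comp (Computable.list_concat.comp (Computable.snd.comp Computable.snd)
      (Computable.fst.comp Computable.snd))
  have hFsucc : ∀ n, F (n + 1) = ext (F n ++ [n]) := fun n => rfl
  have hpre1 : ∀ n, F n ++ [n] <+: F (n + 1) := fun n => by
    rw [hFsucc]
    exact List.prefix_append _ _
  have hpre : ∀ {m n}, m ≤ n → F m <+: F n := by
    intro m n hmn
    induction hmn with
    | refl => exact List.prefix_rfl
    | step _ ih => exact ih.trans ((List.prefix_append _ _).trans (hpre1 _))
  have hlen : ∀ n, n ≤ (F n).length := by
    intro n
    induction n with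
    | zero => exact Nat.zero_le _
    | succ n ih =>
      have := (hpre1 n).length_le
      simp only [List.length_append, List.length_singleton] at this
      omega
  let f : ℕ → ℕ := fun i => ((F (i + 1))[i]?).getD 0
  have hf : Computable f :=
    Computable.option_getD (Computable.list_getElem?.comp (hF.comp Computable.succ) Computable.id)
      (Computable.const 0)
  have hf_eq : ∀ m i, (hi : i < (F m).length) → f i = (F m)[i] := by
    intro m i hi
    have hi' : i < (F (i + 1)).length := hlen (i + 1)
    have : f i = (F (i + 1))[i] := by simp [f, hi']
    rw [this]
    rcases le_total m (i + 1) with h | h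
    · exact ((hpre h).getElem hi).symm
    · exact (hpre h).getElem hi'
  have hseg : ∀ m {l}, l <+: F m → initSeg f l.length = l := by
    intro m l hl
    refine List.ext_getElem (initSeg_length _ _) fun i h1 h2 => ?_
    simp only [initSeg, List.getElem_map, List.getElem_range]
    rw [hf_eq m i (h2.trans_le hl.length_le), hl.getElem h2]
  refine ⟨f, hf, fun n => ?_, fun n N => ?_⟩
  · have : n ∈ initSeg f (F n ++ [n]).length := by
      rw [hseg (n + 1) (hpre1 n)]
      simp
    obtain ⟨i, -, hi⟩ := mem_initSeg.1 this
    exact ⟨i, hi⟩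
  · by_contra! hcon
    have h1 := hcon (F N ++ [N]).length ((hlen N).trans (List.prefix_append _ _).length_le)
    have h2 := hcon (F (N + 1)).length ((Nat.le_succ N).trans (hlen (N + 1)))
    rw [hseg (N + 1) (hpre1 N)] at h1
    rw [hseg (N + 1) List.prefix_rfl, hFsucc] at h2
    exact hext_ne _ (h2.trans h1.symm)

/-! ### Locking sequences -/

theorem exists_isLocking {M' : List ℕ → ℕ} (hM : Computable M') {g : ℕ → ℕ} (hg : Primrec g)
    (h : ∀ f : ℕ → ℕ, Computable f → Set.range f = Set.range g →
      ∃ n N, ∀ i ≥ N, M' (initSeg f i) = n) :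
    ∃ σ, IsLocking M' (Set.range g) σ := by
  by_contra! hno
  have hmap : Computable fun l : List ℕ => l.map g :=
    (Primrec.list_map Primrec.id (hg.comp Primrec.snd).to₂).to_comp
  obtain ⟨f, hf, hsurj, hdiv⟩ :=
    exists_computable_surjective_not_convergent (M' := fun l => M' (l.map g)) (hM.comp hmap) (by
      intro l
      by_contra! hl
      refine hno (l.map g) ⟨fun x hx => ?_, fun ρ hρ => ?_⟩
      · obtain ⟨i, -, rfl⟩ := List.mem_map.1 hx
        exact ⟨i, rfl⟩
      · obtain ⟨r, rfl⟩ := exists_map_eq_of_forall_mem_range hρ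
        rw [← List.map_append]
        exact hl r)
  obtain ⟨n, N, hN⟩ := h (g ∘ f) (hg.to_comp.comp hf) (hsurj.range_comp g)
  obtain ⟨i, hi, hne⟩ := hdiv n N
  exact hne (by rw [← initSeg_comp]; exact hN i hi)

theorem IsLocking.exists_text {M' : List ℕ → ℕ} {g : ℕ → ℕ} (hg : Computable g) {σ : List ℕ}
    (hσ : IsLocking M' (Set.range g) σ) :
    ∃ f : ℕ → ℕ, Computable f ∧ Set.range f = Set.range g ∧
      ∀ i ≥ σ.length, M' (initSeg f i) = M' σ := by
  let f : ℕ → ℕ := fun i => (σ[i]?).getD (g (i - σ.length))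
  have hlt : ∀ i, (hi : i < σ.length) → f i = σ[i] := fun i hi => by simp [f, hi]
  have hge : ∀ j, f (σ.length + j) = g j := fun j => by simp [f]
  have hmem : ∀ i, f i ∈ Set.range g := by
    intro i
    rcases lt_or_ge i σ.length with hi | hi
    · rw [hlt i hi]
      exact hσ.1 _ (List.getElem_mem hi)
    · obtain ⟨j, rfl⟩ := Nat.exists_eq_add_of_le hi
      rw [hge]
      exact ⟨j, rfl⟩
  refine ⟨f, ?_, ?_, fun i hi => ?_⟩
  · exact Computable.option_getD (Computable.list_getElem?.comp (Computable.const σ) Computable.id)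
      (hg.comp (Primrec.nat_sub.to_comp.comp Computable.id (Computable.const σ.length)))
  · refine Set.Subset.antisymm (Set.range_subset_iff.2 hmem) ?_
    rintro _ ⟨j, rfl⟩
    exact ⟨σ.length + j, hge j⟩
  · have hpre : initSeg f σ.length = σ := by
      refine List.ext_getElem (initSeg_length _ _) fun i h1 h2 => ?_
      simp only [initSeg, List.getElem_map, List.getElem_range]
      exact hlt i h2
    have hsplit : initSeg f i = σ ++ (initSeg f i).drop σ.length := by
      conv_lhs => rw [← List.take_append_drop σ.length (initSeg f i), initSeg_take f hi, hpre]
    rw [hsplit]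
    refine hσ.2 _ fun x hx => ?_
    obtain ⟨k, -, rfl⟩ := mem_initSeg.1 (List.mem_of_mem_drop hx)
    exact hmem k

/-! ### The learner searching for a locking sequence -/

/-- The list coded by `k` consists of elements of `L` and looks like a locking sequence for `M'`
as far as the data in `L` can tell. -/
def LooksLocking (M' : List ℕ → ℕ) (L : List ℕ) (k : ℕ) : Prop :=
  (∀ x ∈ Denumerable.ofNat (List ℕ) k, x ∈ L) ∧
    ∀ j < L.length, (∀ x ∈ Denumerable.ofNat (List ℕ) j, x ∈ L) →
      M' (Denumerable.ofNat (List ℕ) k ++ Denumerable.ofNat (List ℕ) j) =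
        M' (Denumerable.ofNat (List ℕ) k)

open Classical in
/-- The learner that conjectures the value of `M'` on the least apparent locking sequence. -/
noncomputable def lockingLearner (M' : List ℕ → ℕ) (L : List ℕ) : ℕ :=
  M' (Denumerable.ofNat (List ℕ) ((List.range L.length).findIdx fun k =>
    decide (LooksLocking M' L k)))

theorem primrecRel_looksLocking {M' : List ℕ → ℕ} (hM : Primrec M') :
    PrimrecRel (LooksLocking M') := by
  have hmem : PrimrecRel fun (x : ℕ) (L : List ℕ) => x ∈ L := by
    have : PrimrecRel fun (L : List ℕ) (x : ℕ) => ∃ a ∈ L, a = x :=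
      PrimrecRel.exists_mem_list Primrec.eq
    exact (this.comp Primrec.snd Primrec.fst).of_eq fun p => by simp
  have hsub : PrimrecRel fun (l L : List ℕ) => ∀ x ∈ l, x ∈ L := hmem.forall_mem_list
  have hofNat : Primrec fun k : ℕ => Denumerable.ofNat (List ℕ) k := Primrec.ofNat (List ℕ)
  have hsub' : PrimrecRel fun (j : ℕ) (L : List ℕ) =>
      ∀ x ∈ Denumerable.ofNat (List ℕ) j, x ∈ L :=
    hsub.comp (hofNat.comp Primrec.fst) Primrec.snd
  have heq : PrimrecRel fun (j : ℕ) (p : List ℕ × ℕ) =>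
      M' (Denumerable.ofNat (List ℕ) p.2 ++ Denumerable.ofNat (List ℕ) j) =
        M' (Denumerable.ofNat (List ℕ) p.2) := by
    have h2 : Primrec fun q : ℕ × List ℕ × ℕ => Denumerable.ofNat (List ℕ) q.2.2 :=
      hofNat.comp (Primrec.snd.comp Primrec.snd)
    exact Primrec.eq.comp (hM.comp (Primrec.list_append.comp h2 (hofNat.comp Primrec.fst)))
      (hM.comp h2)
  have hbody : PrimrecRel fun (j : ℕ) (p : List ℕ × ℕ) =>
      (∀ x ∈ Denumerable.ofNat (List ℕ) j, x ∈ p.1) →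
        M' (Denumerable.ofNat (List ℕ) p.2 ++ Denumerable.ofNat (List ℕ) j) =
          M' (Denumerable.ofNat (List ℕ) p.2) := by
    have hs : PrimrecPred fun q : ℕ × List ℕ × ℕ =>
        ∀ x ∈ Denumerable.ofNat (List ℕ) q.1, x ∈ q.2.1 :=
      hsub'.comp Primrec.fst (Primrec.fst.comp Primrec.snd)
    exact (hs.not.or heq).of_eq fun q => (imp_iff_not_or).symm
  have hs : PrimrecPred fun p : List ℕ × ℕ => ∀ x ∈ Denumerable.ofNat (List ℕ) p.2, x ∈ p.1 :=
    hsub'.comp Primrec.snd Primrec.fst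
  exact hs.and ((hbody.forall_mem_list.comp
    (Primrec.list_range.comp (Primrec.list_length.comp Primrec.fst)) Primrec.id).of_eq
      fun p => by simp)

theorem primrec_lockingLearner {M' : List ℕ → ℕ} (hM : Primrec M') :
    Primrec (lockingLearner M') := by
  classical
  refine hM.comp ((Primrec.ofNat (List ℕ)).comp (Primrec.list_findIdx
    (Primrec.list_range.comp Primrec.list_length) ?_))
  convert (primrecRel_looksLocking hM).decide

theorem eventually_forall_mem_initSeg {f : ℕ → ℕ} {l : List ℕ}
    (hl : ∀ x ∈ l, x ∈ Set.range f) : ∃ N, ∀ i ≥ N, ∀ x ∈ l, x ∈ initSeg f i := by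
  induction l with
  | nil => exact ⟨0, by simp⟩
  | cons a l ih =>
    obtain ⟨N, hN⟩ := ih fun x hx => hl x (List.mem_cons_of_mem _ hx)
    obtain ⟨k, hk⟩ := hl a List.mem_cons_self
    refine ⟨max N (k + 1), fun i hi x hx => ?_⟩
    rcases List.mem_cons.1 hx with rfl | hx
    · exact mem_initSeg.2 ⟨k, by omega, hk⟩
    · exact hN i (by omega) x hx

theorem eventually_not_looksLocking {M' : List ℕ → ℕ} {f : ℕ → ℕ} {k : ℕ}
    (hk : ¬ IsLocking M' (Set.range f) (Denumerable.ofNat (List ℕ) k)) :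
    ∃ N, ∀ i ≥ N, ¬ LooksLocking M' (initSeg f i) k := by
  by_cases hsub : ∀ x ∈ Denumerable.ofNat (List ℕ) k, x ∈ Set.range f
  · obtain ⟨ρ, hρ, hne⟩ : ∃ ρ : List ℕ, (∀ x ∈ ρ, x ∈ Set.range f) ∧
        M' (Denumerable.ofNat (List ℕ) k ++ ρ) ≠ M' (Denumerable.ofNat (List ℕ) k) := by
      by_contra! hcon
      exact hk ⟨hsub, hcon⟩
    obtain ⟨N, hN⟩ := eventually_forall_mem_initSeg hρ
    refine ⟨max N (Encodable.encode ρ + 1), fun i hi hlook => hne ?_⟩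
    have := hlook.2 (Encodable.encode ρ) (by rw [initSeg_length]; omega)
    rw [Denumerable.ofNat_encode] at this
    exact this (hN i (by omega))
  · refine ⟨0, fun i _ hlook => hsub fun x hx => ?_⟩
    obtain ⟨j, -, hj⟩ := mem_initSeg.1 (hlook.1 x hx)
    exact ⟨j, hj⟩

/-- On a text for a set that has a locking sequence, `lockingLearner M'` converges to the value
of `M'` on some locking sequence. -/
theorem lockingLearner_converges {M' : List ℕ → ℕ} {f : ℕ → ℕ}
    (hex : ∃ σ, IsLocking M' (Set.range f) σ) :
    ∃ σ, IsLocking M' (Set.range f) σ ∧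
      ∃ N, ∀ i ≥ N, lockingLearner M' (initSeg f i) = M' σ := by
  classical
  have hex' : ∃ k, IsLocking M' (Set.range f) (Denumerable.ofNat (List ℕ) k) := by
    obtain ⟨σ, hσ⟩ := hex
    exact ⟨Encodable.encode σ, by rwa [Denumerable.ofNat_encode]⟩
  set k := Nat.find hex' with hk_def
  have hk := Nat.find_spec hex'
  rw [← hk_def] at hk
  have hearly : ∀ m ≤ k, ∃ N, ∀ i ≥ N, ∀ k' < m, ¬ LooksLocking M' (initSeg f i) k' := by
    intro m hm
    induction m with
    | zero => exact ⟨0, by simp⟩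
    | succ m ih =>
      obtain ⟨N, hN⟩ := ih (Nat.le_of_succ_le hm)
      obtain ⟨N', hN'⟩ := eventually_not_looksLocking (Nat.find_min hex' (m := m) hm)
      refine ⟨max N N', fun i hi k' hk' => ?_⟩
      rcases Nat.lt_succ_iff_lt_or_eq.1 hk' with h | rfl
      · exact hN i (by omega) k' h
      · exact hN' i (by omega)
  obtain ⟨N₁, hN₁⟩ := hearly k le_rfl
  obtain ⟨N₂, hN₂⟩ := eventually_forall_mem_initSeg hk.1
  refine ⟨_, hk, max (k + 1) (max N₁ N₂), fun i hi => ?_⟩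
  have hlook : LooksLocking M' (initSeg f i) k := by
    refine ⟨hN₂ i (by omega), fun j _ hj => hk.2 _ fun x hx => ?_⟩
    obtain ⟨n, -, hn⟩ := mem_initSeg.1 (hj x hx)
    exact ⟨n, hn⟩
  have hidx : (List.range (initSeg f i).length).findIdx
      (fun k' => decide (LooksLocking M' (initSeg f i) k')) = k := by
    rw [initSeg_length, List.findIdx_eq (by simp; omega)]
    refine ⟨by simpa using hlook, fun j hj => ?_⟩
    simpa using hN₁ i (by omega) j hj
  rw [lockingLearner, hidx]

/-- A family of c.e. sets TxtEx*-learned from computable enumerations by a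
computable learner is TxtEx*-learned from arbitrary enumerations by some
computable learner. -/
theorem blum_blum_star (F : Set (Set ℕ)) (hF : ∀ S ∈ F, ∃ e, S = Wset e)
    (M : List ℕ →. ℕ) (hM : Partrec M)
    (h : ∀ S ∈ F, ∀ f : ℕ → ℕ, Computable f → Set.range f = S →
      TxtExStarIdentifies M f) :
    ∃ N : List ℕ →. ℕ, Partrec N ∧ ∀ S ∈ F, TxtExStarLearnsSet N S := by
  obtain ⟨c, hc⟩ := Code.exists_code.1 hM
  have hcM : ∀ σ : List ℕ, c.eval (Encodable.encode σ) = M σ := fun σ => by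
    simp [hc, Part.map_id']
  have hD := primrec_delayedLearner c
  refine ⟨fun σ => Part.some (lockingLearner (delayedLearner c) σ),
    (primrec_lockingLearner hD).to_comp, fun S hS f hfS => ?_⟩
  obtain ⟨e, he⟩ := hF S hS
  obtain ⟨g, hg, hgS⟩ := exists_primrec_range_eq_Wset (e := e)
    (by rw [← he, ← hfS]; exact Set.range_nonempty f)
  rw [← he] at hgS
  have hlock : ∃ σ, IsLocking (delayedLearner c) (Set.range f) σ := by
    rw [hfS, ← hgS]
    refine exists_isLocking hD.to_comp hg fun t ht htg => ?_
    obtain ⟨n, ⟨N, hN⟩, -⟩ := h S hS t ht (htg.trans hgS)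
    exact ⟨n, delayedLearner_eventually_eq hcM hN⟩
  obtain ⟨σ, hσ, N, hN⟩ := lockingLearner_converges hlock
  refine ⟨delayedLearner c σ, ⟨N, fun i hi => congrArg Part.some (hN i hi)⟩, ?_⟩
  rw [hfS, ← hgS] at hσ
  obtain ⟨t, ht, htg, htσ⟩ := hσ.exists_text hg.to_comp
  obtain ⟨n, ⟨N₁, hN₁⟩, hfin⟩ := h S hS t ht (htg.trans hgS)
  obtain ⟨N₂, hN₂⟩ := delayedLearner_eventually_eq hcM hN₁
  have hn : delayedLearner c σ = n :=
    (htσ _ (le_max_left σ.length N₂)).symm.trans (hN₂ _ (le_max_right _ _))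
  rwa [hn, hfS, ← hgS, ← htg]
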